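/- arXiv:2007.05730 — 2 statements merged into one kernel-verified Lean document; each statement's English description precedes it below -/
import Mathlib

section
/- Let (S,T,α,β) be a matched product system of left inverse semi-braces and suppose that the maps r_S and r_T associated to S and T are set-theoretical solutions of the Yang-Baxter equation. Then the map r_{S⋈T} associated to the matched product S⋈T (the left inverse semi-brace on S×T with (a,u)+(b,v) = (a+b, u+v) and (a,u)·(b,v) = (α_u(α_u⁻¹(a)·b), β_a(β_a⁻¹(u)·v))) is a set-theoretical solution of the Yang-Baxter equation. -/
/-- An inverse semigroup: a semigroup in which every element `a` has a unique
element `inv a` satisfying `a * inv a * a = a` and `inv a * a * inv a = inv a`. -/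
structure InvSemigroup (S : Type*) where
  mul : S → S → S
  inv : S → S
  mul_assoc : ∀ a b c : S, mul (mul a b) c = mul a (mul b c)
  mul_inv_mul : ∀ a : S, mul (mul a (inv a)) a = a
  inv_mul_inv : ∀ a : S, mul (mul (inv a) a) (inv a) = inv a
  inv_unique : ∀ a x : S, mul (mul a x) a = a → mul (mul x a) x = x → x = inv a

/-- A left inverse semi-brace: `(S,+)` a semigroup, `(S,·)` an inverse semigroup,
with `a·(b+c) = a·b + a·(a⁻¹+c)`. -/
structure LeftInvSemiBrace (S : Type*) extends InvSemigroup S where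
  add : S → S → S
  add_assoc : ∀ a b c : S, add (add a b) c = add a (add b c)
  brace : ∀ a b c : S, mul a (add b c) = add (mul a b) (mul a (add (inv a) c))

/-- `λ_a(b) = a·(a⁻¹+b)`. -/
def LeftInvSemiBrace.lam {S : Type*} (B : LeftInvSemiBrace S) (a b : S) : S :=
  B.mul a (B.add (B.inv a) b)

/-- `ρ_b(a) = (a⁻¹+b)⁻¹·b`. -/
def LeftInvSemiBrace.rho {S : Type*} (B : LeftInvSemiBrace S) (b a : S) : S :=
  B.mul (B.inv (B.add (B.inv a) b)) b

/-- The map associated to a left inverse semi-brace: `r(a,b) = (λ_a(b), ρ_b(a))`. -/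
def LeftInvSemiBrace.rmap {S : Type*} (B : LeftInvSemiBrace S) : S × S → S × S :=
  fun p => (B.lam p.1 p.2, B.rho p.2 p.1)

/-- `r × id` on `S × S × S`. -/
def rOne {S : Type*} (r : S × S → S × S) : S × S × S → S × S × S :=
  fun p => ((r (p.1, p.2.1)).1, (r (p.1, p.2.1)).2, p.2.2)

/-- `id × r` on `S × S × S`. -/
def rTwo {S : Type*} (r : S × S → S × S) : S × S × S → S × S × S :=
  fun p => (p.1, r p.2)

/-- `r` is a set-theoretical solution of the Yang-Baxter equation. -/
def IsYBE {S : Type*} (r : S × S → S × S) : Prop :=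
  rOne r ∘ rTwo r ∘ rOne r = rTwo r ∘ rOne r ∘ rTwo r

/-- A matched product system of left inverse semi-braces. -/
structure MatchedSystem {S T : Type*} (BS : LeftInvSemiBrace S) (BT : LeftInvSemiBrace T) where
  α : T → S → S
  α' : T → S → S
  β : S → T → T
  β' : S → T → T
  α_left : ∀ (u : T) (a : S), α' u (α u a) = a
  α_right : ∀ (u : T) (a : S), α u (α' u a) = a
  β_left : ∀ (a : S) (u : T), β' a (β a u) = u
  β_right : ∀ (a : S) (u : T), β a (β' a u) = u
  α_add : ∀ (u : T) (a b : S), α u (BS.add a b) = BS.add (α u a) (α u b)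
  β_add : ∀ (a : S) (u v : T), β a (BT.add u v) = BT.add (β a u) (β a v)
  α_hom : ∀ (u v : T) (a : S), α (BT.mul u v) a = α u (α v a)
  β_hom : ∀ (a b : S) (u : T), β (BS.mul a b) u = β a (β b u)
  mps1 : ∀ (a b : S) (u : T), α u (BS.mul (α' u a) b) = BS.mul a (α (β' a u) b)
  mps2 : ∀ (a : S) (u v : T), β a (BT.mul (β' a u) v) = BT.mul u (β (α' u a) v)
  mps_idem : ∀ (a : S) (u : T), α u (BS.mul (α' u a) a) = a →
    β a (BT.mul (β' a u) u) = u → α u a = a ∧ β a u = u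

namespace InvSemigroup

variable {S : Type*} (I : InvSemigroup S)

theorem mul_inv_idem (a : S) : I.mul (I.mul a (I.inv a)) (I.mul a (I.inv a)) =
    I.mul a (I.inv a) := by
  rw [← I.mul_assoc, I.mul_inv_mul]

theorem inv_mul_idem (a : S) : I.mul (I.mul (I.inv a) a) (I.mul (I.inv a) a) =
    I.mul (I.inv a) a := by
  rw [← I.mul_assoc, I.inv_mul_inv]

theorem eq_mul_inv_of_idem {e : S} (he : I.mul e e = e) : e = I.mul e (I.inv e) := by
  have h : e = I.inv e := I.inv_unique e e (by rw [he, he]) (by rw [he, he])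
  rw [← h, he]

end InvSemigroup

namespace MatchedSystem

variable {S T : Type*} {BS : LeftInvSemiBrace S} {BT : LeftInvSemiBrace T}

/-- The matched product system with the roles of the two semi-braces exchanged. -/
def swap (M : MatchedSystem BS BT) : MatchedSystem BT BS where
  α := M.β
  α' := M.β'
  β := M.α
  β' := M.α'
  α_left := M.β_left
  α_right := M.β_right
  β_left := M.α_left
  β_right := M.α_right
  α_add := M.β_add
  β_add := M.α_add
  α_hom := M.β_hom
  β_hom := M.α_hom
  mps1 a b u := M.mps2 u a b
  mps2 a u v := M.mps1 u v a
  mps_idem a u h k := (M.mps_idem u a k h).symm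

variable (M : MatchedSystem BS BT)

/-- The right action of `S` on `T` attached to a matched product system. -/
def ract (u : T) (s : S) : T := M.β' (M.α u s) u

theorem α_injective (u : T) : Function.Injective (M.α u) :=
  Function.LeftInverse.injective (M.α_left u)

theorem α_of_idem {e : T} (he : BT.mul e e = e) (a : S) : M.α e a = a :=
  M.α_injective e (by rw [← M.α_hom, he])

theorem β_of_idem {e : S} (he : BS.mul e e = e) (u : T) : M.β e u = u :=
  M.swap.α_of_idem he u

theorem β'_of_idem {e : S} (he : BS.mul e e = e) (u : T) : M.β' e u = u := by
  conv_lhs => rw [← M.β_of_idem he u, M.β_left]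

theorem β'_eq (a : S) (u : T) : M.β' a u = M.β (BS.inv a) u := by
  conv_rhs => rw [← M.β_right a u, ← M.β_hom, M.β_of_idem (BS.inv_mul_idem a)]

theorem β'_inv (a : S) (u : T) : M.β' (BS.inv a) u = M.β a u := by
  conv_lhs => rw [← M.β_left a u, M.β'_eq a, M.β_left]

theorem β'_mul (a b : S) (u : T) : M.β' (BS.mul a b) u = M.β' b (M.β' a u) := by
  conv_lhs => rw [← M.β_right a u, ← M.β_right b (M.β' a u), ← M.β_hom, M.β_left]

theorem α_mul (u : T) (s t : S) :
    M.α u (BS.mul s t) = BS.mul (M.α u s) (M.α (M.ract u s) t) := by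
  have h := M.mps1 (M.α u s) t u
  rwa [M.α_left] at h

theorem ract_mul (u : T) (s t : S) : M.ract u (BS.mul s t) = M.ract (M.ract u s) t := by
  unfold ract
  rw [M.α_mul, M.β'_mul]
  rfl

theorem α_ract_inv (u : T) (s : S) :
    M.α (M.ract u s) (BS.inv s) = BS.inv (M.α u s) := by
  set x := M.α' (M.ract u s) (BS.inv (M.α u s)) with hx
  have hαx : M.α (M.ract u s) x = BS.inv (M.α u s) := M.α_right _ _
  have hr : M.ract (M.ract u s) x = u := by
    rw [ract, hαx, M.β'_inv, ract, M.β_right]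
  have h : x = BS.inv s := by
    apply BS.inv_unique
    · apply M.α_injective u
      rw [BS.mul_assoc, M.α_mul, M.α_mul, hr, hαx, ← BS.mul_assoc, BS.mul_inv_mul]
    · apply M.α_injective (M.ract u s)
      rw [BS.mul_assoc, M.α_mul, M.α_mul, hr, hαx, ← BS.mul_assoc, BS.inv_mul_inv]
  rw [← h, hαx]

theorem α_mul_inv (u : T) (s : S) :
    M.α u (BS.mul s (BS.inv s)) = BS.mul (M.α u s) (BS.inv (M.α u s)) := by
  rw [M.α_mul, M.α_ract_inv]

theorem α_idem {e : S} (he : BS.mul e e = e) (u : T) :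
    BS.mul (M.α u e) (M.α u e) = M.α u e := by
  rw [BS.eq_mul_inv_of_idem he, M.α_mul_inv, BS.mul_inv_idem]

theorem ract_of_idem {e : S} (he : BS.mul e e = e) (u : T) : M.ract u e = u :=
  M.β'_of_idem (M.α_idem he u) u

theorem ract_mul_inv (u : T) (s : S) : M.ract (M.ract u s) (BS.inv s) = u := by
  rw [← M.ract_mul, M.ract_of_idem (BS.mul_inv_idem s)]

theorem α_ract_of_idem {e : T} (he : BT.mul e e = e) (s a : S) :
    M.α (M.ract e s) a = a := by
  apply M.α_of_idem
  rw [ract, M.β'_eq]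
  exact M.swap.α_idem he _

theorem α_lam (t : T) (b c : S) :
    M.α t (BS.lam b c) = BS.lam (M.α t b) (M.α (M.ract t b) c) := by
  simp only [LeftInvSemiBrace.lam]
  rw [M.α_mul, M.α_add, M.α_ract_inv]

theorem α_ract_inv_mul (t : T) (d c : S) :
    M.α (M.ract t d) (BS.mul (BS.inv d) c) = BS.mul (BS.inv (M.α t d)) (M.α t c) := by
  rw [M.α_mul, M.α_ract_inv, M.ract_mul_inv]

theorem α_rho (t : T) (b c : S) :
    M.α (M.ract t (BS.lam b c)) (BS.rho c b) = BS.rho (M.α (M.ract t b) c) (M.α t b) := by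
  simp only [LeftInvSemiBrace.lam, LeftInvSemiBrace.rho]
  rw [M.ract_mul, M.α_ract_inv_mul, M.α_add, M.α_ract_inv]

/-- `B` is the matched product `S ⋈ T` given by the system `M`. -/
structure IsProduct (B : LeftInvSemiBrace (S × T)) : Prop where
  add_eq : ∀ p q : S × T, B.add p q = (BS.add p.1 q.1, BT.add p.2 q.2)
  mul_eq : ∀ p q : S × T, B.mul p q =
    (M.α p.2 (BS.mul (M.α' p.2 p.1) q.1), M.β p.1 (BT.mul (M.β' p.1 p.2) q.2))

/-- The action on `S` of the elements of the matched product. -/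
def act (p : S × T) (s : S) : S := M.α (M.β' p.1 p.2) s

theorem act_injective (p : S × T) : Function.Injective (M.act p) := M.α_injective _

/-- The `S`-components of three elements of the matched product, in the coordinates that
turn its associated map into that of `S`. -/
def coord (B : LeftInvSemiBrace (S × T)) (x : (S × T) × (S × T) × (S × T)) : S × S × S :=
  (x.1.1, M.act x.1 x.2.1.1, M.act (B.mul x.1 x.2.1) x.2.2.1)

namespace IsProduct

variable {M} {B : LeftInvSemiBrace (S × T)}

theorem mul_fst (h : M.IsProduct B) (p q : S × T) : (B.mul p q).1 = BS.mul p.1 (M.act p q.1) := by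
  rw [h.mul_eq, M.mps1]
  rfl

theorem act_mul (h : M.IsProduct B) (p q : S × T) (s : S) :
    M.act (B.mul p q) s = M.α (M.ract (M.β' p.1 p.2) q.1) (M.act q s) := by
  have key : M.β' (M.act p q.1) (BT.mul (M.β' p.1 p.2) q.2) =
      BT.mul (M.ract (M.β' p.1 p.2) q.1) (M.β' q.1 q.2) := by
    have h2 := M.mps2 (M.act p q.1) (M.β' p.1 p.2) (M.β' q.1 q.2)
    rw [act, M.α_left, M.β_right] at h2
    rw [act, ← h2, M.β_left]
    rfl
  have h2 : (B.mul p q).2 = M.β p.1 (BT.mul (M.β' p.1 p.2) q.2) := by rw [h.mul_eq]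
  rw [act, h.mul_fst, h2, M.β'_mul, M.β_left, key, M.α_hom]
  rfl

theorem idem (h : M.IsProduct B) {e : S × T} (he : B.mul e e = e) :
    BS.mul e.1 e.1 = e.1 ∧ BT.mul e.2 e.2 = e.2 := by
  rw [h.mul_eq, Prod.ext_iff] at he
  obtain ⟨h1, h2⟩ := he
  obtain ⟨k1, k2⟩ := M.mps_idem _ _ h1 h2
  have l1 : M.α' e.2 e.1 = e.1 := by conv_lhs => rw [← k1, M.α_left]
  have l2 : M.β' e.1 e.2 = e.2 := by conv_lhs => rw [← k2, M.β_left]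
  simp only [l1, l2] at h1 h2
  exact ⟨M.α_injective e.2 (h1.trans k1.symm), M.swap.α_injective e.1 (h2.trans k2.symm)⟩

theorem act_of_idem (h : M.IsProduct B) {e : S × T} (he : B.mul e e = e) (s : S) :
    M.act e s = s := by
  obtain ⟨h1, h2⟩ := h.idem he
  rw [act, M.β'_of_idem h1, M.α_of_idem h2]

theorem act_mul_idem_mul (h : M.IsProduct B) {e : S × T} (he : B.mul e e = e)
    (p q : S × T) (s : S) :
    M.act (B.mul p (B.mul e q)) s = M.act (B.mul p q) s := by
  obtain ⟨h1, h2⟩ := h.idem he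
  rw [h.act_mul, h.act_mul, h.act_mul, h.mul_fst, h.act_of_idem he, M.ract_mul,
    M.ract_of_idem h1, M.β'_of_idem h1, M.α_ract_of_idem h2]

theorem α_ract_act_inv (h : M.IsProduct B) (p : S × T) (s : S) :
    M.α (M.ract (M.β' p.1 p.2) (B.inv p).1) (M.act (B.inv p) s) = s := by
  rw [← h.act_mul, h.act_of_idem (B.mul_inv_idem p)]

theorem act_inv_fst (h : M.IsProduct B) (p : S × T) : M.act p (B.inv p).1 = BS.inv p.1 := by
  apply BS.inv_unique
  · have h1 := congrArg Prod.fst (B.mul_inv_mul p)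
    rwa [h.mul_fst, h.mul_fst, h.act_of_idem (B.mul_inv_idem p)] at h1
  · have h1 := congrArg Prod.fst (B.inv_mul_inv p)
    have h2 := congrArg (M.act p) h1
    have h3 := (h.idem (B.inv_mul_idem p)).1
    rw [h.mul_fst, h.act_of_idem (B.inv_mul_idem p), act, M.α_mul, M.ract_of_idem h3,
      h.mul_fst, M.α_mul, h.α_ract_act_inv] at h2
    exact h2

theorem act_inv_add_fst (h : M.IsProduct B) (p q : S × T) :
    M.act p (B.add (B.inv p) q).1 = BS.add (BS.inv p.1) (M.act p q.1) := by
  rw [h.add_eq, act, M.α_add, ← act, h.act_inv_fst, ← act]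

theorem lam_fst (h : M.IsProduct B) (p q : S × T) : (B.lam p q).1 = BS.lam p.1 (M.act p q.1) := by
  rw [LeftInvSemiBrace.lam, h.mul_fst, h.act_inv_add_fst, LeftInvSemiBrace.lam]

theorem act_lam_rho_fst (h : M.IsProduct B) (p q : S × T) :
    M.act (B.lam p q) (B.rho q p).1 = BS.rho (M.act p q.1) p.1 := by
  simp only [LeftInvSemiBrace.lam, LeftInvSemiBrace.rho]
  rw [← h.act_inv_add_fst]
  generalize B.add (B.inv p) q = d
  have hd : M.act d (B.mul (B.inv d) q).1 = BS.mul (BS.inv d.1) q.1 := by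
    rw [h.mul_fst, act, M.α_mul, h.α_ract_act_inv, ← act, h.act_inv_fst]
  rw [h.act_mul, hd, M.α_ract_inv_mul]
  rfl

theorem act_mul_lam_rho (h : M.IsProduct B) (p q : S × T) (s : S) :
    M.act (B.mul (B.lam p q) (B.rho q p)) s = M.act (B.mul p q) s := by
  simp only [LeftInvSemiBrace.lam, LeftInvSemiBrace.rho]
  generalize B.add (B.inv p) q = d
  rw [B.mul_assoc, ← B.mul_assoc d, h.act_mul_idem_mul (B.mul_inv_idem d)]

theorem coord_rOne (h : M.IsProduct B) (x : (S × T) × (S × T) × (S × T)) :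
    M.coord B (rOne B.rmap x) = rOne BS.rmap (M.coord B x) := by
  simp only [coord, rOne, LeftInvSemiBrace.rmap, h.lam_fst, h.act_lam_rho_fst,
    h.act_mul_lam_rho]

theorem coord_rTwo (h : M.IsProduct B) (x : (S × T) × (S × T) × (S × T)) :
    M.coord B (rTwo B.rmap x) = rTwo BS.rmap (M.coord B x) := by
  simp only [coord, rTwo, LeftInvSemiBrace.rmap, h.act_mul, h.lam_fst, h.act_lam_rho_fst,
    M.α_rho]
  rw [act, M.α_lam]
  rfl

theorem coord_braid (h : M.IsProduct B) (hS : IsYBE BS.rmap) (x : (S × T) × (S × T) × (S × T)) :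
    M.coord B (rOne B.rmap (rTwo B.rmap (rOne B.rmap x))) =
      M.coord B (rTwo B.rmap (rOne B.rmap (rTwo B.rmap x))) := by
  simp only [h.coord_rOne, h.coord_rTwo]
  exact congrFun hS (M.coord B x)

end IsProduct

end MatchedSystem

/-- The transport of a left inverse semi-brace on `S × T` to `T × S`. -/
def LeftInvSemiBrace.prodSwap {S T : Type*} (B : LeftInvSemiBrace (S × T)) :
    LeftInvSemiBrace (T × S) where
  mul p q := (B.mul p.swap q.swap).swap
  inv p := (B.inv p.swap).swap
  mul_assoc a b c := congrArg Prod.swap (B.mul_assoc a.swap b.swap c.swap)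
  mul_inv_mul a := congrArg Prod.swap (B.mul_inv_mul a.swap)
  inv_mul_inv a := congrArg Prod.swap (B.inv_mul_inv a.swap)
  inv_unique a x h k := congrArg Prod.swap
    (B.inv_unique a.swap x.swap (congrArg Prod.swap h) (congrArg Prod.swap k))
  add p q := (B.add p.swap q.swap).swap
  add_assoc a b c := congrArg Prod.swap (B.add_assoc a.swap b.swap c.swap)
  brace a b c := congrArg Prod.swap (B.brace a.swap b.swap c.swap)

namespace MatchedSystem

variable {S T : Type*} {BS : LeftInvSemiBrace S} {BT : LeftInvSemiBrace T}
  {M : MatchedSystem BS BT} {B : LeftInvSemiBrace (S × T)}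

theorem IsProduct.swap (h : M.IsProduct B) : M.swap.IsProduct B.prodSwap where
  add_eq p q := congrArg Prod.swap (h.add_eq p.swap q.swap)
  mul_eq p q := congrArg Prod.swap (h.mul_eq p.swap q.swap)

/-- Exchange of the two coordinates in each of three pairs. -/
def swapTriple (x : (S × T) × (S × T) × (S × T)) : (T × S) × (T × S) × (T × S) :=
  (x.1.swap, x.2.1.swap, x.2.2.swap)

theorem eq_of_coord_eq {x y : (S × T) × (S × T) × (S × T)}
    (h1 : M.coord B x = M.coord B y)
    (h2 : M.swap.coord B.prodSwap (swapTriple x) = M.swap.coord B.prodSwap (swapTriple y)) :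
    x = y := by
  obtain ⟨p, q, r⟩ := x
  obtain ⟨p', q', r'⟩ := y
  simp only [coord, swapTriple, Prod.mk.injEq] at h1 h2
  obtain ⟨a1, a2, a3⟩ := h1
  obtain ⟨b1, b2, b3⟩ := h2
  obtain rfl : p = p' := Prod.ext a1 b1
  obtain rfl : q = q' := Prod.ext (M.act_injective _ a2) (M.swap.act_injective _ b2)
  obtain rfl : r = r' := Prod.ext (M.act_injective _ a3) (M.swap.act_injective _ b3)
  rfl

end MatchedSystem

/-- If the maps associated to `S` and `T` are solutions, then the map associated to
the matched product `S ⋈ T` is a solution of the Yang-Baxter equation. -/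
theorem stmt_6 {S T : Type*} {BS : LeftInvSemiBrace S} {BT : LeftInvSemiBrace T}
    (M : MatchedSystem BS BT)
    (hS : IsYBE BS.rmap) (hT : IsYBE BT.rmap)
    (B : LeftInvSemiBrace (S × T))
    (hadd : ∀ p q : S × T, B.add p q = (BS.add p.1 q.1, BT.add p.2 q.2))
    (hmul : ∀ p q : S × T, B.mul p q =
      (M.α p.2 (BS.mul (M.α' p.2 p.1) q.1), M.β p.1 (BT.mul (M.β' p.1 p.2) q.2))) :
    IsYBE B.rmap := by
  have h : M.IsProduct B := ⟨hadd, hmul⟩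
  funext x
  exact MatchedSystem.eq_of_coord_eq (M := M) (B := B) (h.coord_braid hS x)
    (h.swap.coord_braid hT (MatchedSystem.swapTriple x))
end

section
/- Let (S,·) be an inverse semigroup. Then the map r : S×S → S×S defined by r(a,b) = (a·b, b⁻¹·b) is an idempotent set-theoretical solution of the Yang-Baxter equation, i.e., r satisfies the braid relation and r∘r = r. Likewise, the map r'(a,b) = (a·a⁻¹, a·b) is an idempotent set-theoretical solution of the Yang-Baxter equation. -/
namespace InvSemigroup

variable {S : Type*} (M : InvSemigroup S)

theorem mul_inv_mul_right (a : S) : M.mul a (M.mul (M.inv a) a) = a := by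
  rw [← M.mul_assoc, M.mul_inv_mul]

theorem mul_inv_mul_cancel (a c : S) :
    M.mul a (M.mul (M.inv a) (M.mul a c)) = M.mul a c := by
  rw [← M.mul_assoc, ← M.mul_assoc, M.mul_inv_mul]

theorem inv_mul_inv_right (a : S) : M.mul (M.inv a) (M.mul a (M.inv a)) = M.inv a := by
  rw [← M.mul_assoc, M.inv_mul_inv]

theorem inv_mul_inv_cancel (a c : S) :
    M.mul (M.inv a) (M.mul a (M.mul (M.inv a) c)) = M.mul (M.inv a) c := by
  rw [← M.mul_assoc, ← M.mul_assoc, M.inv_mul_inv]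

theorem inv_inv (a : S) : M.inv (M.inv a) = a :=
  (M.inv_unique _ _ (M.inv_mul_inv a) (M.mul_inv_mul a)).symm

theorem inv_eq_self {e : S} (he : M.mul e e = e) : M.inv e = e :=
  (M.inv_unique e e (by rw [he, he]) (by rw [he, he])).symm

theorem inv_mul_self_idem (a : S) :
    M.mul (M.mul (M.inv a) a) (M.mul (M.inv a) a) = M.mul (M.inv a) a := by
  rw [M.mul_assoc, M.mul_inv_mul_right]

theorem mul_inv_self_idem (a : S) :
    M.mul (M.mul a (M.inv a)) (M.mul a (M.inv a)) = M.mul a (M.inv a) := by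
  rw [M.mul_assoc, M.inv_mul_inv_right]

theorem idem_mul_cancel {e : S} (he : M.mul e e = e) (c : S) :
    M.mul e (M.mul e c) = M.mul e c := by
  rw [← M.mul_assoc, he]

theorem idem_mul_idem {e f : S} (he : M.mul e e = e) (hf : M.mul f f = f) :
    M.mul (M.mul e f) (M.mul e f) = M.mul e f := by
  have h₁ := M.mul_inv_mul_right (M.mul e f)
  have h₂ := M.inv_mul_inv_cancel (M.mul e f)
  generalize hx : M.inv (M.mul e f) = x at h₁ h₂
  simp only [M.mul_assoc] at h₁ h₂
  have hx' : M.mul f (M.mul x e) = x := by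
    rw [← hx]
    apply M.inv_unique <;>
      simp only [hx, M.mul_assoc, M.idem_mul_cancel he, M.idem_mul_cancel hf, h₁, h₂]
  have hxx : M.mul x x = x := by
    conv_lhs => rw [← hx']
    simp only [M.mul_assoc, h₂]
    exact hx'
  have hef : M.mul e f = x := by rw [← M.inv_eq_self hxx, ← hx, M.inv_inv]
  rw [hef, hxx]

theorem idem_comm {e f : S} (he : M.mul e e = e) (hf : M.mul f f = f) :
    M.mul e f = M.mul f e := by
  have h₁ := M.idem_mul_idem he hf
  have h₂ := M.idem_mul_idem hf he
  rw [← M.inv_eq_self h₁]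
  symm
  simp only [M.mul_assoc] at h₁ h₂
  apply M.inv_unique <;>
    simp only [M.mul_assoc, M.idem_mul_cancel he, M.idem_mul_cancel hf, h₁, h₂]

theorem mul_inv_inv_mul_comm (a b c : S) :
    M.mul b (M.mul (M.inv b) (M.mul (M.inv a) (M.mul a c))) =
      M.mul (M.inv a) (M.mul a (M.mul b (M.mul (M.inv b) c))) := by
  have h := congrArg (M.mul · c)
    (M.idem_comm (M.mul_inv_self_idem b) (M.inv_mul_self_idem a))
  simpa only [M.mul_assoc] using h

theorem inv_mul (a b : S) : M.inv (M.mul a b) = M.mul (M.inv b) (M.inv a) := by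
  symm
  apply M.inv_unique
  · simp only [M.mul_assoc, M.mul_inv_inv_mul_comm, M.mul_inv_mul_cancel, M.mul_inv_mul_right]
  · simp only [M.mul_assoc, ← M.mul_inv_inv_mul_comm, M.inv_mul_inv_cancel, M.inv_mul_inv_right]

end InvSemigroup

/-- For any inverse semigroup, the maps `r(a,b) = (a·b, b⁻¹·b)` and
`r'(a,b) = (a·a⁻¹, a·b)` are idempotent solutions of the Yang-Baxter equation. -/
theorem stmt_18 {S : Type*} (M : InvSemigroup S)
    (r r' : S × S → S × S)
    (hr : ∀ a b : S, r (a, b) = (M.mul a b, M.mul (M.inv b) b))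
    (hr' : ∀ a b : S, r' (a, b) = (M.mul a (M.inv a), M.mul a b)) :
    (IsYBE r ∧ r ∘ r = r) ∧ (IsYBE r' ∧ r' ∘ r' = r') := by
  have hmap : ∀ p : S × S, r p = (M.mul p.1 p.2, M.mul (M.inv p.2) p.2) := fun p => hr p.1 p.2
  have hmap' : ∀ p : S × S, r' p = (M.mul p.1 (M.inv p.1), M.mul p.1 p.2) := fun p => hr' p.1 p.2
  refine ⟨⟨?_, ?_⟩, ?_, ?_⟩ <;> funext p <;>
    simp only [rOne, rTwo, Function.comp_apply, hmap, hmap', M.mul_assoc, M.inv_mul, M.inv_inv,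
      M.mul_inv_mul_right, M.mul_inv_mul_cancel, M.inv_mul_inv_right, M.inv_mul_inv_cancel]
end
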